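/- Suppose the space of positive angle structures A is nonempty and α in the closure of A maximizes the volume functional 𝒱 over the closure of A. Then for every i ∈ Fin n, if some coordinate α(i,j) lies in {0, π}, the triple (α(i,0), α(i,1), α(i,2)) is a permutation of (0, 0, π). -/

import Mathlib

open Real

/-- The Lobachevsky function `Λ(x) = -∫₀ˣ log |2 sin t| dt`. -/
noncomputable def lob (x : ℝ) : ℝ := -∫ t in (0:ℝ)..x, Real.log |2 * Real.sin t|

/-- The space of positive angle structures for a triangulation with `n` tetrahedra and
edge-coefficient data `c : E → (Fin n × Fin 3) → ℕ`: every angle lies in `(0,π)`, the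
three angles of each tetrahedron sum to `π`, and each edge equation
`Σ c(e)(i,j)·θ(i,j) = 2π` holds. -/
def angleStructures (n : ℕ) {E : Type*} [Fintype E]
    (c : E → (Fin n × Fin 3) → ℕ) : Set (Fin n × Fin 3 → ℝ) :=
  {θ | (∀ x, θ x ∈ Set.Ioo 0 π) ∧
       (∀ i : Fin n, θ (i, 0) + θ (i, 1) + θ (i, 2) = π) ∧
       (∀ e : E, ∑ x : Fin n × Fin 3, (c e x : ℝ) * θ x = 2 * π)}

/-- The volume functional `𝒱(θ) = Σ Λ(θ(i,j))`. -/
noncomputable def volFun (n : ℕ) (θ : Fin n × Fin 3 → ℝ) : ℝ :=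
  ∑ x : Fin n × Fin 3, lob (θ x)

open Set Filter Topology MeasureTheory

theorem intervalIntegrable_log_abs_two_mul_sin (a b : ℝ) :
    IntervalIntegrable (fun t => Real.log |2 * Real.sin t|) volume a b := by
  have h : MeromorphicOn (fun t : ℝ => 2 * Real.sin t) (uIcc a b) := fun t _ =>
    (by fun_prop : AnalyticAt ℝ (fun t : ℝ => 2 * Real.sin t) t).meromorphicAt
  exact h.intervalIntegrable_log_norm

theorem lob_zero : lob 0 = 0 := by simp [lob]

theorem lob_sub_lob (a b : ℝ) :
    lob b - lob a = -∫ t in a..b, Real.log |2 * Real.sin t| := by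
  have h := intervalIntegral.integral_add_adjacent_intervals
    (intervalIntegrable_log_abs_two_mul_sin 0 a) (intervalIntegrable_log_abs_two_mul_sin a b)
  simp only [lob]
  linarith

theorem lob_pi_sub (x : ℝ) : lob (π - x) = lob π - lob x := by
  have h := intervalIntegral.integral_comp_sub_left
    (fun t => Real.log |2 * Real.sin t|) π (a := 0) (b := x)
  simp only [Real.sin_pi_sub, sub_zero] at h
  have h' := lob_sub_lob (π - x) π
  rw [← h] at h'
  simp only [lob] at h' ⊢
  linarith

theorem log_abs_two_mul_sin_le {s t : ℝ} (hs : 0 < s) (hst : s ≤ t) (ht : t ≤ π / 2) :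
    Real.log |2 * Real.sin s| ≤ Real.log |2 * Real.sin t| := by
  have hpos : 0 < Real.sin s := Real.sin_pos_of_pos_of_lt_pi hs (by linarith [Real.pi_pos])
  have hle : Real.sin s ≤ Real.sin t :=
    Real.sin_le_sin_of_le_of_le_pi_div_two (by linarith) ht hst
  rw [abs_of_pos (by positivity), abs_of_pos (by linarith)]
  exact Real.log_le_log (by positivity) (by linarith)

/-- The Lobachevsky function is subadditive on `[0, π/2]`. -/
theorem lob_add_le {x y : ℝ} (hx : 0 ≤ x) (hy : 0 ≤ y) (hxy : x + y ≤ π / 2) :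
    lob (x + y) ≤ lob x + lob y := by
  have hshift := intervalIntegral.integral_comp_add_left
    (fun t => Real.log |2 * Real.sin t|) x (a := 0) (b := y)
  have hint : IntervalIntegrable (fun t => Real.log |2 * Real.sin (x + t)|) volume 0 y := by
    have := (intervalIntegrable_log_abs_two_mul_sin x (x + y)).comp_add_left x
    simpa using this
  have hmono := intervalIntegral.integral_mono_on_of_le_Ioo hy
    (intervalIntegrable_log_abs_two_mul_sin 0 y) hint
    (fun t ht => log_abs_two_mul_sin_le ht.1 (by linarith) (by linarith [ht.2]))
  have h := lob_sub_lob x (x + y)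
  rw [hshift, add_zero] at hmono
  have hlob : lob y = -∫ t in (0:ℝ)..y, Real.log |2 * Real.sin t| := rfl
  linarith

theorem neg_mul_log_le_lob {x : ℝ} (hx : 0 < x) (hx' : x ≤ π / 2) :
    -(x * Real.log (2 * x)) ≤ lob x := by
  have hmono := intervalIntegral.integral_mono_on_of_le_Ioo hx.le
    (intervalIntegrable_log_abs_two_mul_sin 0 x)
    (intervalIntegrable_const (c := Real.log (2 * x)))
    (fun t ht => by
      refine (log_abs_two_mul_sin_le ht.1 ht.2.le hx').trans ?_
      have hpos : 0 < Real.sin x := Real.sin_pos_of_pos_of_lt_pi hx (by linarith [Real.pi_pos])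
      rw [abs_of_pos (by positivity)]
      exact Real.log_le_log (by positivity) (by linarith [Real.sin_le hx.le]))
  rw [intervalIntegral.integral_const, sub_zero, smul_eq_mul] at hmono
  simp only [lob]
  linarith

theorem hasDerivAt_lob {x : ℝ} (hx : x ∈ Ioo 0 π) :
    HasDerivAt lob (-Real.log |2 * Real.sin x|) x := by
  have hpos : 0 < Real.sin x := Real.sin_pos_of_mem_Ioo hx
  have hmeas : Measurable (fun t => Real.log |2 * Real.sin t|) := by fun_prop
  have hcont : ContinuousAt (fun t => Real.log |2 * Real.sin t|) x :=
    ContinuousAt.log (by fun_prop) (by positivity)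
  exact (intervalIntegral.integral_hasDerivAt_right
    (intervalIntegrable_log_abs_two_mul_sin 0 x)
    hmeas.stronglyMeasurable.stronglyMeasurableAtFilter hcont).neg

/-- The increment of `f` from `0` is at least `C * t` for all small positive `t`. -/
def HasLowerSlope (f : ℝ → ℝ) (C : ℝ) : Prop :=
  ∀ᶠ t in 𝓝[>] (0:ℝ), C * t ≤ f t - f 0

theorem HasLowerSlope.add {f g : ℝ → ℝ} {C D : ℝ} (hf : HasLowerSlope f C)
    (hg : HasLowerSlope g D) : HasLowerSlope (fun t => f t + g t) (C + D) := by
  filter_upwards [hf, hg] with t h₁ h₂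
  linarith

theorem HasLowerSlope.sum {ι : Type*} (s : Finset ι) {f : ι → ℝ → ℝ} {C : ι → ℝ}
    (h : ∀ i ∈ s, HasLowerSlope (f i) (C i)) :
    HasLowerSlope (fun t => ∑ i ∈ s, f i t) (∑ i ∈ s, C i) := by
  filter_upwards [(Filter.eventually_all_finset s).2 h] with t ht
  rw [Finset.sum_mul, ← Finset.sum_sub_distrib]
  exact Finset.sum_le_sum ht

theorem eventually_mul_lt (d : ℝ) {ε : ℝ} (hε : 0 < ε) : ∀ᶠ t in 𝓝[>] (0:ℝ), t * d < ε := by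
  have h : Tendsto (fun t : ℝ => t * d) (𝓝 0) (𝓝 (0 * d)) :=
    (continuous_id.mul continuous_const).tendsto 0
  rw [zero_mul] at h
  exact (h.mono_left nhdsWithin_le_nhds).eventually_lt_const hε

/-- The one-sided derivative of the Lobachevsky function at `0` is `+∞`. -/
theorem hasLowerSlope_lob_zero {d : ℝ} (hd : 0 < d) (C : ℝ) :
    HasLowerSlope (fun t => lob (0 + t * d)) C := by
  filter_upwards [self_mem_nhdsWithin, eventually_mul_lt d (half_pos Real.pi_pos),
    eventually_mul_lt (2 * d) (Real.exp_pos (-(C / d)))] with t ht h₁ h₂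
  have ht : 0 < t := ht
  have htd : 0 < t * d := by positivity
  have hlog : Real.log (2 * (t * d)) ≤ -(C / d) := by
    rw [Real.log_le_iff_le_exp (by positivity)]
    linarith
  have h := neg_mul_log_le_lob htd h₁.le
  have h' := mul_le_mul_of_nonneg_left hlog htd.le
  have h'' : t * d * -(C / d) = -(C * t) := by field_simp
  simp only [zero_add, zero_mul, lob_zero, sub_zero]
  linarith

theorem exists_hasLowerSlope_lob {a d : ℝ} (ha : 0 ≤ a) (ha' : a < π) (hd : a = 0 → 0 < d) :
    ∃ C, HasLowerSlope (fun t => lob (a + t * d)) C := by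
  rcases ha.eq_or_lt with rfl | hpos
  · exact ⟨0, hasLowerSlope_lob_zero (hd rfl) 0⟩
  have hder : HasDerivAt (fun t : ℝ => lob (a + t * d)) (-Real.log |2 * Real.sin a| * d) 0 := by
    have hlin : HasDerivAt (fun t : ℝ => a + t * d) d 0 := by
      simpa using ((hasDerivAt_id (0:ℝ)).mul_const d).const_add a
    have hlob : HasDerivAt lob (-Real.log |2 * Real.sin a|) (a + 0 * d) := by
      simpa using hasDerivAt_lob ⟨hpos, ha'⟩
    exact HasDerivAt.comp (h₂ := lob) (0:ℝ) hlob hlin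
  obtain ⟨K, hK⟩ := hder.isBigO_sub.bound
  refine ⟨-K, ?_⟩
  filter_upwards [self_mem_nhdsWithin, hK.filter_mono nhdsWithin_le_nhds] with t ht h
  have ht : 0 < t := ht
  simp only [sub_zero, Real.norm_eq_abs, abs_of_pos ht] at h
  linarith [(abs_le.1 h).1]

theorem hasLowerSlope_lob_flat {d e f : ℝ} (hd : 0 < d) (he : 0 < e) (hsum : d + e + f = 0) :
    HasLowerSlope (fun t => lob (0 + t * d) + lob (0 + t * e) + lob (π + t * f)) 0 := by
  filter_upwards [self_mem_nhdsWithin, eventually_mul_lt (d + e) (half_pos Real.pi_pos)]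
    with t ht h
  have ht : 0 < t := ht
  obtain rfl : f = -(d + e) := by linarith
  have hsub := lob_add_le (x := t * d) (y := t * e) (by positivity) (by positivity)
    (by linarith)
  have hrefl := lob_pi_sub (t * d + t * e)
  have hangle : π + t * -(d + e) = π - (t * d + t * e) := by ring
  simp only [hangle, hrefl, zero_add, zero_mul, add_zero, lob_zero]
  linarith

/-- Along a segment issuing from a Euclidean triple of angles towards the interior, the volume
decreases at most linearly. -/
theorem exists_hasLowerSlope_lob_triple {a d : Fin 3 → ℝ} (ha : ∀ j, 0 ≤ a j)
    (hsum : a 0 + a 1 + a 2 = π) (hdsum : d 0 + d 1 + d 2 = 0)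
    (hd : ∀ j, a j = 0 → 0 < d j) :
    ∃ C, HasLowerSlope (fun t => ∑ j, lob (a j + t * d j)) C := by
  have h0 := ha 0
  have h1 := ha 1
  have h2 := ha 2
  by_cases hp : ∃ j, a j = π
  · refine ⟨0, ?_⟩
    simp only [Fin.sum_univ_three]
    obtain ⟨j, hj⟩ := hp
    fin_cases j
    · replace hj : a 0 = π := hj
      have e1 : a 1 = 0 := by linarith
      have e2 : a 2 = 0 := by linarith
      have h := hasLowerSlope_lob_flat (hd 1 e1) (hd 2 e2) (by linarith : d 1 + d 2 + d 0 = 0)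
      rw [hj, e1, e2]
      convert h using 2
      ring
    · replace hj : a 1 = π := hj
      have e1 : a 0 = 0 := by linarith
      have e2 : a 2 = 0 := by linarith
      have h := hasLowerSlope_lob_flat (hd 0 e1) (hd 2 e2) (by linarith : d 0 + d 2 + d 1 = 0)
      rw [hj, e1, e2]
      convert h using 2
      ring
    · replace hj : a 2 = π := hj
      have e1 : a 0 = 0 := by linarith
      have e2 : a 1 = 0 := by linarith
      have h := hasLowerSlope_lob_flat (hd 0 e1) (hd 1 e2) (by linarith : d 0 + d 1 + d 2 = 0)
      rw [hj, e1, e2]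
      exact h
  · push Not at hp
    have hle : ∀ j, a j ≤ π := by
      intro j
      fin_cases j <;> simp only [Fin.zero_eta, Fin.mk_one, Fin.reduceFinMk] <;> linarith
    choose C hC using fun j => exists_hasLowerSlope_lob (ha j) ((hle j).lt_of_ne (hp j)) (hd j)
    exact ⟨_, HasLowerSlope.sum Finset.univ fun j _ => hC j⟩

/-- If the initial triple has an angle `0` but no angle `π`, the volume increases with infinite
initial slope. -/
theorem hasLowerSlope_lob_triple_of_eq_zero {a d : Fin 3 → ℝ} (ha : ∀ j, 0 ≤ a j)
    (hlt : ∀ j, a j < π) (hd : ∀ j, a j = 0 → 0 < d j) {j₀ : Fin 3} (hj₀ : a j₀ = 0) (C : ℝ) :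
    HasLowerSlope (fun t => ∑ j, lob (a j + t * d j)) C := by
  choose D hD using fun j => exists_hasLowerSlope_lob (ha j) (hlt j) (hd j)
  have hrest := HasLowerSlope.sum (Finset.univ.erase j₀) fun j _ => hD j
  have hzero := hasLowerSlope_lob_zero (hd j₀ hj₀) (C - ∑ j ∈ Finset.univ.erase j₀, D j)
  rw [← hj₀] at hzero
  have h := hzero.add hrest
  rw [sub_add_cancel] at h
  convert h using 2 with t
  exact (Finset.add_sum_erase _ _ (Finset.mem_univ j₀)).symm

theorem convex_angleStructures (n : ℕ) {E : Type*} [Fintype E]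
    (c : E → (Fin n × Fin 3) → ℕ) : Convex ℝ (angleStructures n c) := by
  intro x hx y hy a b ha hb hab
  refine ⟨fun z => convex_Ioo (0:ℝ) π (hx.1 z) (hy.1 z) ha hb hab, fun i => ?_, fun e => ?_⟩
  · simp only [Pi.add_apply, Pi.smul_apply, smul_eq_mul]
    linear_combination a * hx.2.1 i + b * hy.2.1 i + π * hab
  · simp only [Pi.add_apply, Pi.smul_apply, smul_eq_mul]
    have h : ∑ z, (c e z : ℝ) * (a * x z + b * y z) =
        a * ∑ z, (c e z : ℝ) * x z + b * ∑ z, (c e z : ℝ) * y z := by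
      rw [Finset.mul_sum, Finset.mul_sum, ← Finset.sum_add_distrib]
      exact Finset.sum_congr rfl fun z _ => by ring
    rw [h]
    linear_combination a * hx.2.2 e + b * hy.2.2 e + 2 * π * hab

theorem nonneg_of_mem_closure_angleStructures {n : ℕ} {E : Type*} [Fintype E]
    {c : E → (Fin n × Fin 3) → ℕ} {α : Fin n × Fin 3 → ℝ}
    (hα : α ∈ closure (angleStructures n c)) (x : Fin n × Fin 3) : 0 ≤ α x :=
  closure_minimal (t := {θ : Fin n × Fin 3 → ℝ | 0 ≤ θ x}) (fun _ hθ => (hθ.1 x).1.le)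
    (isClosed_le continuous_const (continuous_apply x)) hα

theorem sum_eq_pi_of_mem_closure_angleStructures {n : ℕ} {E : Type*} [Fintype E]
    {c : E → (Fin n × Fin 3) → ℕ} {α : Fin n × Fin 3 → ℝ}
    (hα : α ∈ closure (angleStructures n c)) (i : Fin n) :
    α (i, 0) + α (i, 1) + α (i, 2) = π :=
  closure_minimal (t := {θ : Fin n × Fin 3 → ℝ | θ (i, 0) + θ (i, 1) + θ (i, 2) = π})
    (fun _ hθ => hθ.2.1 i) (isClosed_eq (by fun_prop) continuous_const) hα

theorem multiset_eq_of_eq_pi {a : Fin 3 → ℝ} (ha : ∀ j, 0 ≤ a j)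
    (hsum : a 0 + a 1 + a 2 = π) {j : Fin 3} (hj : a j = π) :
    ({a 0, a 1, a 2} : Multiset ℝ) = {0, 0, π} := by
  have h0 := ha 0
  have h1 := ha 1
  have h2 := ha 2
  fin_cases j
  · replace hj : a 0 = π := hj
    rw [hj, show a 1 = 0 by linarith, show a 2 = 0 by linarith, Multiset.insert_eq_cons,
      Multiset.insert_eq_cons, Multiset.cons_swap, Multiset.pair_comm]
    rfl
  · replace hj : a 1 = π := hj
    rw [hj, show a 0 = 0 by linarith, show a 2 = 0 by linarith, Multiset.pair_comm]
  · replace hj : a 2 = π := hj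
    rw [hj, show a 0 = 0 by linarith, show a 1 = 0 by linarith]

/-- If `α` maximizes the volume functional over the closure of a nonempty space of
positive angle structures, then any tetrahedron of `α` having an angle in `{0, π}` has
angles `0`, `0`, `π` in some order. -/
theorem maximizer_flat_tetrahedra (n : ℕ) (hn : 1 ≤ n) (E : Type*) [Fintype E]
    (c : E → (Fin n × Fin 3) → ℕ)
    (hne : (angleStructures n c).Nonempty)
    (α : Fin n × Fin 3 → ℝ) (hα : α ∈ closure (angleStructures n c))
    (hmax : ∀ β ∈ closure (angleStructures n c), volFun n β ≤ volFun n α) :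
    ∀ i : Fin n, (∃ j : Fin 3, α (i, j) = 0 ∨ α (i, j) = π) →
      ({α (i, 0), α (i, 1), α (i, 2)} : Multiset ℝ) = {0, 0, π} := by
  rintro i ⟨j₀, hj₀⟩
  obtain ⟨β, hβ⟩ := hne
  have hnonneg := nonneg_of_mem_closure_angleStructures hα
  have hsum := sum_eq_pi_of_mem_closure_angleStructures hα
  have hd : ∀ x, α x = 0 → 0 < β x - α x := fun x hx => by
    rw [hx, sub_zero]
    exact (hβ.1 x).1
  by_cases hp : ∃ j, α (i, j) = π
  · obtain ⟨j, hj⟩ := hp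
    exact multiset_eq_of_eq_pi (a := fun j => α (i, j)) (fun j => hnonneg (i, j)) (hsum i) hj
  exfalso
  push Not at hp
  have hj₀ : α (i, j₀) = 0 := hj₀.resolve_right (hp j₀)
  have hlt : ∀ j, α (i, j) < π := fun j => lt_of_le_of_ne (by
    have h0 := hnonneg (i, 0)
    have h1 := hnonneg (i, 1)
    have h2 := hnonneg (i, 2)
    have h := hsum i
    fin_cases j <;> simp only [Fin.zero_eta, Fin.mk_one, Fin.reduceFinMk] <;> linarith) (hp j)
  choose C hC using fun k : Fin n => exists_hasLowerSlope_lob_triple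
    (a := fun j => α (k, j)) (d := fun j => β (k, j) - α (k, j)) (fun j => hnonneg (k, j))
    (hsum k) (by linarith [hsum k, hβ.2.1 k]) (fun j => hd (k, j))
  have hrest := HasLowerSlope.sum (Finset.univ.erase i) fun k _ => hC k
  have hi := hasLowerSlope_lob_triple_of_eq_zero
    (a := fun j => α (i, j)) (d := fun j => β (i, j) - α (i, j)) (fun j => hnonneg (i, j))
    hlt (fun j => hd (i, j)) hj₀ (1 - ∑ k ∈ Finset.univ.erase i, C k)
  have htotal := hi.add hrest
  rw [sub_add_cancel] at htotal
  have hvol : ∀ t : ℝ, volFun n (fun x => α x + t * (β x - α x)) =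
      ∑ j, lob (α (i, j) + t * (β (i, j) - α (i, j))) +
      ∑ k ∈ Finset.univ.erase i, ∑ j, lob (α (k, j) + t * (β (k, j) - α (k, j))) := fun t => by
    rw [volFun, Fintype.sum_prod_type, Finset.add_sum_erase _
      (fun k => ∑ j, lob (α (k, j) + t * (β (k, j) - α (k, j)))) (Finset.mem_univ i)]
  obtain ⟨t, ht, ht0, ht1⟩ := (htotal.and
    (eventually_mem_nhdsWithin.and (eventually_mul_lt 1 one_pos))).exists
  have ht0 : 0 < t := ht0
  beta_reduce at ht
  rw [← hvol t, ← hvol 0] at ht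
  simp only [zero_mul, add_zero, one_mul] at ht
  have hmem : (fun x => α x + t * (β x - α x)) ∈ closure (angleStructures n c) := by
    convert (convex_angleStructures n c).closure hα (subset_closure hβ)
      (show 0 ≤ 1 - t by linarith) ht0.le (by ring) using 1
    ext x
    simp only [Pi.add_apply, Pi.smul_apply, smul_eq_mul]
    ring
  linarith [hmax _ hmem]
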